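/- arXiv:1908.01639 — 2 statements merged into one kernel-verified Lean document; each statement's English description precedes it below -/
import Mathlib

section
/- Let u : ℝⁿ → ℝ be harmonic on a ball B of radius 2r centered at x, and suppose u does not vanish anywhere on B. If y, z are two points in the ball of radius r centered at x, then |u(y)| ≤ C |u(z)| for a constant C depending only on the dimension n (and not on u, x, r). -/
/-- The Euclidean Laplacian of a function. -/
noncomputable def lap {m : ℕ} (u : EuclideanSpace ℝ (Fin m) → ℝ)
    (x : EuclideanSpace ℝ (Fin m)) : ℝ :=
  ∑ i : Fin m, fderiv ℝ (fun y => fderiv ℝ u y (EuclideanSpace.single i (1:ℝ))) x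
      (EuclideanSpace.single i (1:ℝ))

open MeasureTheory

noncomputable def hPhi {m : ℕ} (y : EuclideanSpace ℝ (Fin m)) : ℝ := (max 0 (1 - ‖y‖ ^ 2)) ^ 2

noncomputable def hPsi {m : ℕ} (y : EuclideanSpace ℝ (Fin m)) : ℝ := (max 0 (1 - ‖y‖ ^ 2)) ^ 3

lemma hPhi_cont {m : ℕ} : Continuous (hPhi (m := m)) := by unfold hPhi; fun_prop

lemma hPsi_cont {m : ℕ} : Continuous (hPsi (m := m)) := by unfold hPsi; fun_prop

lemma hmax_zero {m : ℕ} {y : EuclideanSpace ℝ (Fin m)} (hy : 1 ≤ ‖y‖) :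
    max 0 (1 - ‖y‖ ^ 2) = 0 := by
  apply max_eq_left; nlinarith

lemma hPhi_zero {m : ℕ} {y : EuclideanSpace ℝ (Fin m)} (hy : 1 ≤ ‖y‖) : hPhi y = 0 := by
  unfold hPhi; rw [hmax_zero hy]; norm_num

lemma hPsi_zero {m : ℕ} {y : EuclideanSpace ℝ (Fin m)} (hy : 1 ≤ ‖y‖) : hPsi y = 0 := by
  unfold hPsi; rw [hmax_zero hy]; norm_num

lemma hPhi_nonneg {m : ℕ} (y : EuclideanSpace ℝ (Fin m)) : 0 ≤ hPhi y := by
  unfold hPhi; positivity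

lemma hPhi_le_one {m : ℕ} (y : EuclideanSpace ℝ (Fin m)) : hPhi y ≤ 1 := by
  unfold hPhi
  apply pow_le_one₀ (le_max_left _ _)
  apply max_le (by norm_num)
  nlinarith [sq_nonneg ‖y‖]

lemma hPhi_half {m : ℕ} {y : EuclideanSpace ℝ (Fin m)} (hy : ‖y‖ ≤ 1 / 2) : 1 / 2 ≤ hPhi y := by
  unfold hPhi
  have h : 3 / 4 ≤ max 0 (1 - ‖y‖ ^ 2) := by
    apply le_max_of_le_right
    nlinarith [norm_nonneg y]
  nlinarith

lemma integrable_of_zero {m : ℕ} {f : EuclideanSpace ℝ (Fin m) → ℝ} (hf : Continuous f)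
    (h : ∀ y, 1 ≤ ‖y‖ → f y = 0) : Integrable f := by
  apply hf.integrable_of_hasCompactSupport
  apply HasCompactSupport.intro (isCompact_closedBall (0 : EuclideanSpace ℝ (Fin m)) 1)
  intro y hy
  apply h
  simp at hy
  exact hy.le

lemma hPhi_integral_pos {m : ℕ} : 0 < ∫ y : EuclideanSpace ℝ (Fin m), hPhi y := by
  apply hPhi_cont.integral_pos_of_hasCompactSupport_nonneg_nonzero (x := 0)
  · apply HasCompactSupport.intro (isCompact_closedBall (0 : EuclideanSpace ℝ (Fin m)) 1)
    intro y hy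
    apply hPhi_zero
    simp at hy
    exact hy.le
  · exact hPhi_nonneg
  · simp [hPhi]

lemma max_cube_hasDerivAt (s : ℝ) :
    HasDerivAt (fun s : ℝ => (max 0 s) ^ 3) (3 * (max 0 s) ^ 2) s := by
  rcases lt_trichotomy s 0 with h | h | h
  · rw [max_eq_left h.le]
    have : (fun s : ℝ => (max 0 s) ^ 3) =ᶠ[nhds s] fun _ => 0 := by
      filter_upwards [gt_mem_nhds h] with t ht
      rw [max_eq_left ht.le]; norm_num
    simpa using (hasDerivAt_const s (0 : ℝ)).congr_of_eventuallyEq this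
  · subst h
    rw [hasDerivAt_iff_isLittleO]
    simp only [max_self, sub_zero, ne_eq, OfNat.ofNat_ne_zero, not_false_eq_true, zero_pow,
      mul_zero, smul_zero]
    have h1 : (fun s : ℝ => (max 0 s) ^ 3) =O[nhds 0] fun s : ℝ => s ^ 3 := by
      apply Asymptotics.isBigO_of_le
      intro s
      rw [norm_pow, norm_pow]
      apply pow_le_pow_left₀ (norm_nonneg _)
      rcases le_total 0 s with h | h
      · rw [max_eq_right h]
      · rw [max_eq_left h]; simp
    exact h1.trans_isLittleO (by simpa using Asymptotics.isLittleO_pow_id (𝕜 := ℝ) (n := 3) (by norm_num))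
  · rw [max_eq_right h.le]
    have : (fun s : ℝ => (max 0 s) ^ 3) =ᶠ[nhds s] fun s => s ^ 3 := by
      filter_upwards [lt_mem_nhds h] with t ht
      rw [max_eq_right ht.le]
    simpa using (hasDerivAt_pow 3 s).congr_of_eventuallyEq this

lemma hPsi_hasFDerivAt {m : ℕ} (y : EuclideanSpace ℝ (Fin m)) :
    HasFDerivAt hPsi ((-6 * hPhi y) • innerSL ℝ y) y := by
  have h1 := ((hasStrictFDerivAt_norm_sq y).hasFDerivAt).const_sub 1
  have h2 := (max_cube_hasDerivAt (1 - ‖y‖ ^ 2)).comp_hasFDerivAt y h1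
  refine h2.congr_fderiv ?_
  ext v
  simp [hPhi]
  ring

lemma hPsi_fderiv {m : ℕ} (y : EuclideanSpace ℝ (Fin m)) (i : Fin m) :
    fderiv ℝ hPsi y (EuclideanSpace.single i (1:ℝ)) = -6 * hPhi y * y i := by
  rw [(hPsi_hasFDerivAt y).fderiv]
  simp [EuclideanSpace.inner_single_right]

lemma mvp_parts {m : ℕ} (U : EuclideanSpace ℝ (Fin m) → ℝ) (hU : ContDiff ℝ 2 U)
    (x : EuclideanSpace ℝ (Fin m)) (T : ℝ) (hl : ∀ p ∈ Metric.ball x T, lap U p = 0)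
    (t : ℝ) (ht0 : 0 ≤ t) (ht : t ≤ T) :
    ∫ y, fderiv ℝ U (x + t • y) y * hPhi y = 0 := by
  have hdU : ContDiff ℝ 1 (fderiv ℝ U) := hU.fderiv_right (by norm_num)
  set e : Fin m → EuclideanSpace ℝ (Fin m) := fun i => EuclideanSpace.single i (1:ℝ) with he
  have hD : ∀ i, ContDiff ℝ 1 (fun p => fderiv ℝ U p (e i)) := fun i => hdU.clm_apply contDiff_const
  have hV : ∀ i, ContDiff ℝ 1 (fun y => fderiv ℝ U (x + t • y) (e i)) := fun i =>
    (hD i).comp (by fun_prop : ContDiff ℝ 1 fun y : EuclideanSpace ℝ (Fin m) => x + t • y)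
  have hVd : ∀ i y, fderiv ℝ (fun y => fderiv ℝ U (x + t • y) (e i)) y (e i)
      = t * fderiv ℝ (fun p => fderiv ℝ U p (e i)) (x + t • y) (e i) := by
    intro i y
    have h1 : HasFDerivAt (fun y : EuclideanSpace ℝ (Fin m) => x + t • y)
        (t • ContinuousLinearMap.id ℝ _) y := ((hasFDerivAt_id y).const_smul t).const_add x
    have h2 := (((hD i).differentiable (by norm_num)) (x + t • y)).hasFDerivAt.comp y h1
    have h3 := h2.fderiv
    simp only [Function.comp_def] at h3
    rw [h3]
    simp
  have hVc : ∀ i, Continuous fun y => fderiv ℝ (fun y => fderiv ℝ U (x + t • y) (e i)) y (e i) :=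
    fun i => ((hV i).continuous_fderiv (by norm_num)).clm_apply continuous_const
  have hcoord : ∀ i : Fin m, Continuous fun y : EuclideanSpace ℝ (Fin m) => y i := by
    intro i; fun_prop
  have hpt : ∀ y, fderiv ℝ U (x + t • y) y * hPhi y
      = ∑ i, (-1 / 6) * (fderiv ℝ U (x + t • y) (e i) * fderiv ℝ hPsi y (e i)) := by
    intro y
    have hy : y = ∑ i, y i • e i := by
      have := (EuclideanSpace.basisFun (Fin m) ℝ).sum_repr y
      simpa [he] using this.symm
    have : fderiv ℝ U (x + t • y) y = ∑ i, y i * fderiv ℝ U (x + t • y) (e i) := by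
      conv_lhs => rw [hy]
      rw [map_sum]
      simp only [map_smul, smul_eq_mul]
      rw [← hy]
    rw [this, Finset.sum_mul]
    apply Finset.sum_congr rfl
    intro i _
    rw [hPsi_fderiv]
    ring
  have i1 : ∀ i, Integrable fun y => fderiv ℝ (fun y => fderiv ℝ U (x + t • y) (e i)) y (e i) * hPsi y :=
    fun i => integrable_of_zero ((hVc i).mul hPsi_cont) (fun y hy => by rw [hPsi_zero hy, mul_zero])
  have i2 : ∀ i, Integrable fun y => fderiv ℝ U (x + t • y) (e i) * fderiv ℝ hPsi y (e i) := by
    intro i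
    simp only [he, hPsi_fderiv]
    refine integrable_of_zero ((hV i).continuous.mul
      ((continuous_const.mul hPhi_cont).mul (hcoord i))) (fun y hy => ?_)
    rw [hPhi_zero hy]; ring
  have i3 : ∀ i, Integrable fun y => fderiv ℝ U (x + t • y) (e i) * hPsi y :=
    fun i => integrable_of_zero ((hV i).continuous.mul hPsi_cont)
      (fun y hy => by rw [hPsi_zero hy, mul_zero])
  have parts : ∀ i, ∫ y, fderiv ℝ U (x + t • y) (e i) * fderiv ℝ hPsi y (e i)
      = - ∫ y, fderiv ℝ (fun y => fderiv ℝ U (x + t • y) (e i)) y (e i) * hPsi y := fun i =>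
    integral_mul_fderiv_eq_neg_fderiv_mul_of_integrable (i1 i) (i2 i) (i3 i)
      (fun y _ => (hV i).differentiable (by norm_num) y)
      (fun y _ => (hPsi_hasFDerivAt y).differentiableAt)
  simp only [hpt]
  rw [integral_finsetSum _ (fun i _ => (i2 i).const_mul _)]
  simp only [integral_const_mul, parts]
  rw [← Finset.mul_sum, Finset.sum_neg_distrib, ← integral_finsetSum _ (fun i _ => i1 i)]
  have : ∀ y, ∑ i, fderiv ℝ (fun y => fderiv ℝ U (x + t • y) (e i)) y (e i) * hPsi y = 0 := by
    intro y
    rw [← Finset.sum_mul]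
    simp only [hVd]
    rw [← Finset.mul_sum]
    rcases le_or_gt 1 ‖y‖ with hy | hy
    · rw [hPsi_zero hy, mul_zero]
    · rcases ht0.eq_or_lt with h0 | h0
      · rw [← h0]; simp
      have : lap U (x + t • y) = 0 := by
        apply hl
        simp [norm_smul, abs_of_pos h0]
        nlinarith
      unfold lap at this
      simp only [he]
      rw [this]; simp
  simp [this]

lemma mvp {m : ℕ} (U : EuclideanSpace ℝ (Fin m) → ℝ) (hU : ContDiff ℝ 2 U)
    (x : EuclideanSpace ℝ (Fin m)) (T : ℝ) (hT : 0 ≤ T) (hl : ∀ p ∈ Metric.ball x T, lap U p = 0) :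
    ∫ y, U (x + T • y) * hPhi y = U x * ∫ y : EuclideanSpace ℝ (Fin m), hPhi y := by
  have hdU : Continuous (fderiv ℝ U) := hU.continuous_fderiv (by norm_num)
  have hUc := hU.continuous
  have hcF : Continuous fun q : ℝ × EuclideanSpace ℝ (Fin m) => fderiv ℝ U (x + q.1 • q.2) q.2 := by
    apply Continuous.clm_apply _ continuous_snd
    exact hdU.comp (by fun_prop)
  have hphi := hPhi_cont (m := m)
  have hder : ∀ t : ℝ, HasDerivAt (fun t : ℝ => ∫ y, U (x + t • y) * hPhi y)
      (∫ y, fderiv ℝ U (x + t • y) y * hPhi y) t := by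
    intro t
    obtain ⟨C, hC⟩ := ((isCompact_closedBall t 1).prod (isCompact_closedBall
      (0 : EuclideanSpace ℝ (Fin m)) 1)).exists_bound_of_continuousOn hcF.continuousOn
    refine (hasDerivAt_integral_of_dominated_loc_of_deriv_le (bound := fun y => C * hPhi y)
      (F' := fun t y => fderiv ℝ U (x + t • y) y * hPhi y)
      (Metric.closedBall_mem_nhds t one_pos) ?_ ?_ ?_ ?_ ?_ ?_).2
    · refine Filter.Eventually.of_forall fun s => Continuous.aestronglyMeasurable ?_
      fun_prop
    · apply integrable_of_zero (by fun_prop)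
      intro y hy; rw [hPhi_zero hy, mul_zero]
    · apply Continuous.aestronglyMeasurable
      exact (hcF.comp (by fun_prop : Continuous fun y : EuclideanSpace ℝ (Fin m) => (t, y))).mul hphi
    · refine Filter.Eventually.of_forall fun y s hs => ?_
      rcases le_or_gt 1 ‖y‖ with hy | hy
      · rw [hPhi_zero hy]; simp
      · rw [norm_mul, Real.norm_of_nonneg (hPhi_nonneg y)]
        apply mul_le_mul_of_nonneg_right _ (hPhi_nonneg y)
        exact hC (s, y) ⟨hs, by simpa using hy.le⟩
    · apply integrable_of_zero (by fun_prop)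
      intro y hy; rw [hPhi_zero hy, mul_zero]
    · refine Filter.Eventually.of_forall fun y s _ => ?_
      apply HasDerivAt.mul_const
      have h1 : HasDerivAt (fun s : ℝ => x + s • y) y s := by
        simpa using ((hasDerivAt_id s).smul_const y).const_add x
      exact ((hU.differentiable (by norm_num) (x + s • y)).hasFDerivAt).comp_hasDerivAt s h1
  have := constant_of_has_deriv_right_zero (f := fun t : ℝ => ∫ y, U (x + t • y) * hPhi y)
    (a := 0) (b := T) (fun t _ => (hder t).continuousAt.continuousWithinAt) (fun t ht => by
      have := hder t
      rw [mvp_parts U hU x T hl t ht.1 ht.2.le] at this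
      exact this.hasDerivWithinAt) T ⟨hT, le_rfl⟩
  simp only [zero_smul, add_zero] at this
  rw [this, integral_const_mul]

lemma harnack_step {m : ℕ} (U : EuclideanSpace ℝ (Fin m) → ℝ) (hU : ContDiff ℝ 2 U)
    (x : EuclideanSpace ℝ (Fin m)) (r : ℝ) (hr : 0 < r)
    (hl : ∀ p ∈ Metric.ball x (2 * r), lap U p = 0) (hp : ∀ p ∈ Metric.ball x (2 * r), 0 ≤ U p)
    (y z : EuclideanSpace ℝ (Fin m)) (hy : y ∈ Metric.ball x r) (hz : z ∈ Metric.ball x r)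
    (hyz : ‖y - z‖ ≤ r / 4) : U y ≤ 2 * 4 ^ m * U z := by
  have sub : ∀ w ∈ Metric.ball x r, ∀ p ∈ Metric.ball w r, p ∈ Metric.ball x (2 * r) := by
    intro w hw p hp
    rw [Metric.mem_ball] at *
    linarith [dist_triangle p w x]
  have hUc := hU.continuous
  have hphi := hPhi_cont (m := m)
  have my := mvp U hU y (r / 4) (by positivity) (fun p hp => hl p (sub y hy p
    (Metric.ball_subset_ball (by linarith) hp)))
  have mz := mvp U hU z r hr.le (fun p hp => hl p (sub z hz p hp))
  set A := ∫ y : EuclideanSpace ℝ (Fin m), hPhi y with hA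
  have hApos : 0 < A := hPhi_integral_pos
  set a : EuclideanSpace ℝ (Fin m) := r⁻¹ • (y - z) with ha
  have han : ‖a‖ ≤ 1 / 4 := by
    rw [ha, norm_smul, norm_inv, Real.norm_of_nonneg hr.le, inv_mul_le_iff₀ hr]
    linarith
  set G : EuclideanSpace ℝ (Fin m) → ℝ := fun w => U (z + r • w) * hPhi w with hG
  have hGc : Continuous G := by rw [hG]; fun_prop
  have hpt : ∀ w, z + r • (a + (1 / 4 : ℝ) • w) = y + (r / 4) • w := by
    intro w
    rw [ha, smul_add, smul_smul, smul_smul, mul_inv_cancel₀ hr.ne']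
    have : r * (1 / 4) = r / 4 := by ring
    rw [this]; module
  have h1 : ∫ w, G (a + (1 / 4 : ℝ) • w) = 4 ^ m * (U z * A) := by
    rw [Measure.integral_comp_smul volume (fun w => G (a + w)) (1 / 4),
      integral_add_left_eq_self G a, mz]
    simp
  have hGi : Integrable G := integrable_of_zero hGc (fun w hw => by simp [hG, hPhi_zero hw])
  have hGi' : Integrable fun w => G (a + (1 / 4 : ℝ) • w) :=
    (hGi.comp_add_left a).comp_smul (by norm_num)
  have h2 : ∫ w, (1 / 2 : ℝ) * (U (y + (r / 4) • w) * hPhi w) ≤ ∫ w, G (a + (1 / 4 : ℝ) • w) := by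
    refine integral_mono ?_ hGi' ?_
    · apply integrable_of_zero (by fun_prop)
      intro w hw; rw [hPhi_zero hw]; ring
    · intro w
      simp only [hG, hpt]
      rcases le_or_gt 1 ‖w‖ with hw | hw
      · rw [hPhi_zero hw]
        simp only [mul_zero]
        rcases le_or_gt 1 ‖a + (1 / 4 : ℝ) • w‖ with hw' | hw'
        · rw [hPhi_zero hw', mul_zero]
        · apply mul_nonneg _ (hPhi_nonneg _)
          rw [← hpt]
          apply hp _ (sub z hz _ _)
          simp only [Metric.mem_ball, dist_self_add_left, norm_smul, Real.norm_of_nonneg hr.le]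
          nlinarith
      · have hn : ‖a + (1 / 4 : ℝ) • w‖ ≤ 1 / 2 := by
          refine (norm_add_le _ _).trans ?_
          have h6 : ‖(1 / 4 : ℝ) • w‖ = 1 / 4 * ‖w‖ := by
            rw [norm_smul, Real.norm_of_nonneg (by norm_num)]
          rw [h6]; linarith
        have h3 := hPhi_half hn
        have h4 := hPhi_le_one w
        have h5 : 0 ≤ U (y + (r / 4) • w) := by
          apply hp _ (sub y hy _ _)
          simp only [Metric.mem_ball, dist_self_add_left, norm_smul]
          rw [Real.norm_of_nonneg (by positivity)]
          nlinarith [norm_nonneg w]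
        calc 1 / 2 * (U (y + (r / 4) • w) * hPhi w) = U (y + (r / 4) • w) * (1 / 2 * hPhi w) := by ring
          _ ≤ _ := mul_le_mul_of_nonneg_left (by linarith) h5
  rw [integral_const_mul, my, h1] at h2
  have : U y * A ≤ 2 * 4 ^ m * U z * A := by linarith
  exact le_of_mul_le_mul_right this hApos

lemma harnack_global {m : ℕ} (U : EuclideanSpace ℝ (Fin m) → ℝ) (hU : ContDiff ℝ 2 U)
    (x : EuclideanSpace ℝ (Fin m)) (r : ℝ) (hr : 0 < r)
    (hl : ∀ p ∈ Metric.ball x (2 * r), lap U p = 0) (hp : ∀ p ∈ Metric.ball x (2 * r), 0 ≤ U p)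
    (y z : EuclideanSpace ℝ (Fin m)) (hy : y ∈ Metric.ball x r) (hz : z ∈ Metric.ball x r) :
    U y ≤ (2 * 4 ^ m) ^ 8 * U z := by
  have key : ∀ k : ℕ, k ≤ 8 →
      U (z + ((k : ℝ) / 8) • (y - z)) ≤ (2 * 4 ^ m) ^ k * U z := by
    have hmem : ∀ k : ℕ, k ≤ 8 → z + ((k : ℝ) / 8) • (y - z) ∈ Metric.ball x r := by
      intro k hk
      have hk' : (k : ℝ) ≤ 8 := by exact_mod_cast hk
      exact (convex_ball x r).add_smul_sub_mem hz hy ⟨by positivity, by linarith⟩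
    intro k
    induction k with
    | zero => intro _; simp
    | succ k ih =>
      intro hk
      have := harnack_step U hU x r hr hl hp _ _ (hmem (k + 1) hk) (hmem k (by omega)) (by
        have : z + (((k + 1 : ℕ) : ℝ) / 8) • (y - z) - (z + ((k : ℝ) / 8) • (y - z))
            = (1 / 8 : ℝ) • (y - z) := by
          push_cast; module
        rw [this, norm_smul]
        have : ‖y - z‖ < 2 * r := by
          rw [← dist_eq_norm]
          rw [Metric.mem_ball] at *
          linarith [dist_triangle_right y z x]
        norm_num
        linarith)
      calc _ ≤ _ := this
        _ ≤ 2 * 4 ^ m * ((2 * 4 ^ m) ^ k * U z) :=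
          mul_le_mul_of_nonneg_left (ih (by omega)) (by positivity)
        _ = _ := by ring
  have := key 8 le_rfl
  norm_num at this
  simpa using this

lemma harnack_pos {m : ℕ} (u : EuclideanSpace ℝ (Fin m) → ℝ)
    (x : EuclideanSpace ℝ (Fin m)) (r : ℝ) (hr : 0 < r)
    (hu : ContDiffOn ℝ 2 u (Metric.ball x (2 * r)))
    (hl : ∀ p ∈ Metric.ball x (2 * r), lap u p = 0) (hp : ∀ p ∈ Metric.ball x (2 * r), 0 ≤ u p)
    (y z : EuclideanSpace ℝ (Fin m)) (hy : y ∈ Metric.ball x r) (hz : z ∈ Metric.ball x r) :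
    u y ≤ (2 * 4 ^ m) ^ 8 * u z := by
  obtain ⟨s, hs1, hs2⟩ : ∃ s, max (dist y x) (dist z x) < s ∧ s < r :=
    exists_between (max_lt hy hz)
  have hs0 : 0 < s := lt_of_le_of_lt (le_max_of_le_left dist_nonneg) hs1
  let f : ContDiffBump x := ⟨2 * s, s + r, by positivity, by linarith⟩
  set U : EuclideanSpace ℝ (Fin m) → ℝ := fun p => f p * u p with hUdef
  have hUu : ∀ p ∈ Metric.ball x (2 * s), U p = u p := by
    intro p hp
    have : f p = 1 := f.one_of_mem_closedBall (Metric.ball_subset_closedBall hp)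
    simp [hUdef, this]
  have hU : ContDiff ℝ 2 U := by
    rw [contDiff_iff_contDiffAt]
    intro p
    by_cases h : p ∈ Metric.ball x (2 * r)
    · exact f.contDiff.contDiffAt.mul (hu.contDiffAt (Metric.isOpen_ball.mem_nhds h))
    · have h' : p ∈ (tsupport f)ᶜ := by
        rw [f.tsupport_eq]
        simp only [Set.mem_compl_iff, Metric.mem_closedBall, Metric.mem_ball] at *
        change ¬ (dist p x ≤ s + r)
        linarith
      have : U =ᶠ[nhds p] fun _ => 0 := by
        filter_upwards [(isClosed_tsupport f).isOpen_compl.mem_nhds h'] with q hq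
        simp [hUdef, image_eq_zero_of_notMem_tsupport hq]
      exact contDiffAt_const.congr_of_eventuallyEq this
  have hss : Metric.ball x (2 * s) ⊆ Metric.ball x (2 * r) := Metric.ball_subset_ball (by linarith)
  have hev : ∀ p ∈ Metric.ball x (2 * s), U =ᶠ[nhds p] u := fun p hp => by
    filter_upwards [Metric.isOpen_ball.mem_nhds hp] with q hq using hUu q hq
  have hlU : ∀ p ∈ Metric.ball x (2 * s), lap U p = 0 := by
    intro p hp
    rw [← hl p (hss hp)]
    unfold lap
    apply Finset.sum_congr rfl
    intro i _
    have : (fun y => fderiv ℝ U y (EuclideanSpace.single i (1:ℝ))) =ᶠ[nhds p]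
        (fun y => fderiv ℝ u y (EuclideanSpace.single i (1:ℝ))) := by
      filter_upwards [Metric.isOpen_ball.mem_nhds hp] with q hq
      rw [(hev q hq).fderiv_eq]
    rw [this.fderiv_eq]
  have hy' : y ∈ Metric.ball x s := lt_of_le_of_lt (le_max_left _ _) hs1
  have hz' : z ∈ Metric.ball x s := lt_of_le_of_lt (le_max_right _ _) hs1
  have hs3 : Metric.ball x s ⊆ Metric.ball x (2 * s) := Metric.ball_subset_ball (by linarith)
  have := harnack_global U hU x s hs0 hlU (fun p hp' => by
    rw [hUu p hp']; exact hp p (hss hp')) y z hy' hz'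
  rwa [hUu y (hs3 hy'), hUu z (hs3 hz')] at this

lemma lap_neg {m : ℕ} (u : EuclideanSpace ℝ (Fin m) → ℝ) (p : EuclideanSpace ℝ (Fin m)) :
    lap (fun q => - u q) p = - lap u p := by
  unfold lap
  simp [fderiv_fun_neg]

/-- Harnack inequality for nonvanishing harmonic functions. -/
theorem harnack_nonvanishing (n : ℕ) (hn : 1 ≤ n) :
    ∃ C > 0, ∀ (u : EuclideanSpace ℝ (Fin n) → ℝ) (x : EuclideanSpace ℝ (Fin n)) (r : ℝ),
      0 < r →
      ContDiffOn ℝ 2 u (Metric.ball x (2*r)) →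
      (∀ p ∈ Metric.ball x (2*r), lap u p = 0) →
      (∀ p ∈ Metric.ball x (2*r), u p ≠ 0) →
      ∀ y ∈ Metric.ball x r, ∀ z ∈ Metric.ball x r, |u y| ≤ C * |u z| := by
  refine ⟨(2 * 4 ^ n) ^ 8, by positivity, ?_⟩
  intro u x r hr hu hl hne y hy z hz
  have hss : Metric.ball x r ⊆ Metric.ball x (2 * r) := Metric.ball_subset_ball (by linarith)
  have hpre : IsPreconnected (Metric.ball x (2 * r)) := (convex_ball x (2 * r)).isPreconnected
  have hx : x ∈ Metric.ball x (2 * r) := Metric.mem_ball_self (by positivity)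
  rcases lt_or_gt_of_ne (hne x hx) with h | h
  · have hneg : ∀ p ∈ Metric.ball x (2 * r), u p ≤ 0 := by
      intro p hp
      by_contra hc
      obtain ⟨q, hq, hq0⟩ := hpre.intermediate_value hx hp hu.continuousOn ⟨h.le, (not_le.1 hc).le⟩
      exact hne q hq hq0
    rw [abs_of_nonpos (hneg y (hss hy)), abs_of_nonpos (hneg z (hss hz))]
    exact harnack_pos (fun q => - u q) x r hr hu.neg
      (fun p hp => by rw [lap_neg, hl p hp, neg_zero])
      (fun p hp => neg_nonneg.2 (hneg p hp)) y z hy hz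
  · have hpos : ∀ p ∈ Metric.ball x (2 * r), 0 ≤ u p := by
      intro p hp
      by_contra hc
      obtain ⟨q, hq, hq0⟩ := hpre.intermediate_value hp hx hu.continuousOn ⟨(not_le.1 hc).le, h.le⟩
      exact hne q hq hq0
    rw [abs_of_nonneg (hpos y (hss hy)), abs_of_nonneg (hpos z (hss hz))]
    exact harnack_pos u x r hr hu hl hpos y z hy hz
end

section
/- Let D ⊆ ℂ be open and h : D → ℝ smooth. For every f ∈ C_c^∞(D; ℂ), ∫_D |∂̄f|² e^h ≥ (1/4) ∫_D (Δh) |f|² e^h, where ∂̄f = (∂_x f + i ∂_y f)/2. -/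
/-- The planar Laplacian ∂²/∂x² + ∂²/∂y² of a function on ℂ ≅ ℝ². -/
noncomputable def planarLap {E : Type*} [NormedAddCommGroup E] [NormedSpace ℝ E]
    (h : ℂ → E) (z : ℂ) : E :=
  fderiv ℝ (fun w => fderiv ℝ h w 1) z 1 +
    fderiv ℝ (fun w => fderiv ℝ h w Complex.I) z Complex.I


open MeasureTheory in
lemma cb_int_zero (F : ℂ → ℝ) (hF : ContDiff ℝ 1 F) (hc : HasCompactSupport F) (e : ℂ) :
    Integrable (fun z => fderiv ℝ F z e) ∧ ∫ z, fderiv ℝ F z e = 0 := by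
  have hi : Integrable (fun z => fderiv ℝ F z e) := by
    apply Continuous.integrable_of_hasCompactSupport
    · exact (hF.continuous_fderiv one_ne_zero).clm_apply continuous_const
    · exact hc.fderiv_apply (𝕜 := ℝ) e
  refine ⟨hi, ?_⟩
  have := integral_mul_fderiv_eq_neg_fderiv_mul_of_integrable (𝕜 := ℝ) (μ := (volume : Measure ℂ))
    (f := fun _ : ℂ => (1:ℝ)) (g := F) (v := e) (by simp) (by simpa using hi)
    (by simpa using hF.continuous.integrable_of_hasCompactSupport hc)
    (by fun_prop) (fun x _ => hF.differentiable one_ne_zero x)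
  simpa using this

lemma cb_smooth (u : ℂ → ℝ) (hu : ContDiff ℝ (⊤ : ℕ∞) u) (e : ℂ) :
    ContDiff ℝ (⊤ : ℕ∞) (fun z => fderiv ℝ u z e) :=
  (hu.fderiv_right (m := (⊤ : ℕ∞)) (by norm_cast)).clm_apply contDiff_const

lemma cb_symm (u : ℂ → ℝ) (hu : ContDiff ℝ (⊤ : ℕ∞) u) (z a b : ℂ) :
    fderiv ℝ (fun w => fderiv ℝ u w a) z b = fderiv ℝ (fun w => fderiv ℝ u w b) z a := by
  have hd : DifferentiableAt ℝ (fderiv ℝ u) z :=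
    ((hu.fderiv_right (m := (⊤ : ℕ∞)) (by norm_cast)).differentiable (by simp)) z
  have hs : IsSymmSndFDerivAt ℝ u z :=
    hu.contDiffAt.isSymmSndFDerivAt (by simp [minSmoothness_of_isRCLikeNormedField]; exact WithTop.coe_le_coe.2 le_top)
  rw [fderiv_clm_apply hd (by fun_prop), fderiv_clm_apply hd (by fun_prop)]
  simpa using hs b a

open MeasureTheory in
lemma cb_global (u v h : ℂ → ℝ) (hu : ContDiff ℝ (⊤ : ℕ∞) u) (hv : ContDiff ℝ (⊤ : ℕ∞) v)
    (hh : ContDiff ℝ (⊤ : ℕ∞) h) (cu : HasCompactSupport u) (cv : HasCompactSupport v) :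
    ∫ z, planarLap h z * ((u z)^2 + (v z)^2) * Real.exp (h z) ≤
      ∫ z, ((fderiv ℝ u z 1 - fderiv ℝ v z Complex.I)^2 +
        (fderiv ℝ v z 1 + fderiv ℝ u z Complex.I)^2) * Real.exp (h z) := by
  have su := cb_smooth u hu
  have sv := cb_smooth v hv
  have sh := cb_smooth h hh
  have cux := fun e => cu.fderiv_apply (𝕜 := ℝ) e
  have cvx := fun e => cv.fderiv_apply (𝕜 := ℝ) e
  have sE : ContDiff ℝ (⊤ : ℕ∞) (fun z => Real.exp (h z)) := hh.exp
  set V : ℂ → ℝ := fun z => Real.exp (h z) * (fderiv ℝ h z 1 * ((u z)^2 + (v z)^2) +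
    2 * (u z * fderiv ℝ v z Complex.I - v z * fderiv ℝ u z Complex.I)) with hV
  set W : ℂ → ℝ := fun z => Real.exp (h z) * (fderiv ℝ h z Complex.I * ((u z)^2 + (v z)^2) +
    2 * (v z * fderiv ℝ u z 1 - u z * fderiv ℝ v z 1)) with hW
  have key0 : ∀ z, z ∉ tsupport u ∪ tsupport v → u z = 0 ∧ v z = 0 ∧
      (∀ e, fderiv ℝ u z e = 0) ∧ (∀ e, fderiv ℝ v z e = 0) := by
    intro z hz
    simp only [Set.mem_union, not_or] at hz
    refine ⟨image_eq_zero_of_notMem_tsupport hz.1, image_eq_zero_of_notMem_tsupport hz.2, ?_, ?_⟩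
    · intro e
      rw [fderiv_of_notMem_tsupport ℝ hz.1]; rfl
    · intro e
      rw [fderiv_of_notMem_tsupport ℝ hz.2]; rfl
  have hK : IsCompact (tsupport u ∪ tsupport v) := IsCompact.union cu cv
  have dV : ContDiff ℝ (⊤ : ℕ∞) V :=
    sE.mul (((sh 1).mul ((hu.pow 2).add (hv.pow 2))).add
      (contDiff_const.mul ((hu.mul (sv _)).sub (hv.mul (su _)))))
  have dW : ContDiff ℝ (⊤ : ℕ∞) W :=
    sE.mul (((sh _).mul ((hu.pow 2).add (hv.pow 2))).add
      (contDiff_const.mul ((hv.mul (su _)).sub (hu.mul (sv _)))))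
  have cV : HasCompactSupport V := HasCompactSupport.intro hK fun z hz => by
    obtain ⟨h1, h2, h3, h4⟩ := key0 z hz
    simp [hV, h1, h2]
  have cW : HasCompactSupport W := HasCompactSupport.intro hK fun z hz => by
    obtain ⟨h1, h2, h3, h4⟩ := key0 z hz
    simp [hW, h1, h2]
  obtain ⟨iV, zV⟩ := cb_int_zero V (dV.of_le (by norm_cast)) cV 1
  obtain ⟨iW, zW⟩ := cb_int_zero W (dW.of_le (by norm_cast)) cW Complex.I
  have hLc : Continuous (planarLap h) :=
    (cb_smooth _ (sh 1) 1).continuous.add (cb_smooth _ (sh Complex.I) Complex.I).continuous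
  have iA : Integrable (fun z => planarLap h z * ((u z)^2 + (v z)^2) * Real.exp (h z)) := by
    apply Continuous.integrable_of_hasCompactSupport
    · exact (hLc.mul ((hu.continuous.pow 2).add (hv.continuous.pow 2))).mul sE.continuous
    · exact HasCompactSupport.intro hK fun z hz => by
        obtain ⟨h1, h2, h3, h4⟩ := key0 z hz
        simp [h1, h2]
  have iB : Integrable (fun z => ((fderiv ℝ u z 1 - fderiv ℝ v z Complex.I)^2 +
        (fderiv ℝ v z 1 + fderiv ℝ u z Complex.I)^2) * Real.exp (h z)) := by
    apply Continuous.integrable_of_hasCompactSupport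
    · exact (((((su _).sub (sv _)).pow 2).add (((sv _).add (su _)).pow 2)).mul sE).continuous
    · exact HasCompactSupport.intro hK fun z hz => by
        obtain ⟨h1, h2, h3, h4⟩ := key0 z hz
        simp [h3, h4]
  have eq0 : ∫ z, (planarLap h z * ((u z)^2 + (v z)^2) * Real.exp (h z)) =
      ∫ z, (planarLap h z * ((u z)^2 + (v z)^2) * Real.exp (h z)
        - (fderiv ℝ V z 1 + fderiv ℝ W z Complex.I)) := by
    have iVW : Integrable (fun z => fderiv ℝ V z 1 + fderiv ℝ W z Complex.I) := iV.add iW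
    rw [integral_sub iA iVW, integral_add iV iW, zV, zW]; simp
  rw [eq0]
  refine integral_mono (iA.sub (iV.add iW)) iB fun z => ?_
  have D : ∀ {g : ℂ → ℝ}, ContDiff ℝ (⊤ : ℕ∞) g → HasFDerivAt g (fderiv ℝ g z) z :=
    fun hg => (hg.differentiable (by simp) z).hasFDerivAt
  have eV := ((D hh).exp.mul (((D (sh 1)).mul (((D hu).pow 2).add ((D hv).pow 2))).add
      ((((D hu).mul (D (sv Complex.I))).sub ((D hv).mul (D (su Complex.I)))).const_mul 2))).fderiv
  have eW := ((D hh).exp.mul (((D (sh Complex.I)).mul (((D hu).pow 2).add ((D hv).pow 2))).add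
      ((((D hv).mul (D (su 1))).sub ((D hu).mul (D (sv 1)))).const_mul 2))).fderiv
  have eV' := congrArg (fun L : ℂ →L[ℝ] ℝ => L 1) eV
  have eW' := congrArg (fun L : ℂ →L[ℝ] ℝ => L Complex.I) eW
  have fV : fderiv ℝ V z 1 = _ := eV'
  have fW : fderiv ℝ W z Complex.I = _ := eW'
  have s1 := cb_symm u hu z 1 Complex.I
  have s2 := cb_symm v hv z 1 Complex.I
  show planarLap h z * ((u z)^2 + (v z)^2) * Real.exp (h z)
        - (fderiv ℝ V z 1 + fderiv ℝ W z Complex.I) ≤ _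
  rw [fV, fW]
  simp only [ContinuousLinearMap.add_apply, ContinuousLinearMap.sub_apply,
    ContinuousLinearMap.smul_apply, smul_eq_mul, Pi.add_apply, Pi.mul_apply, Pi.sub_apply,
    Pi.pow_apply, planarLap, s1, s2]
  have hE := Real.exp_pos (h z)
  have hq := mul_nonneg hE.le (add_nonneg
    (sq_nonneg ((fderiv ℝ u z 1 + fderiv ℝ h z 1 * u z) +
      (fderiv ℝ v z Complex.I + fderiv ℝ h z Complex.I * v z)))
    (sq_nonneg ((fderiv ℝ v z 1 + fderiv ℝ h z 1 * v z) -
      (fderiv ℝ u z Complex.I + fderiv ℝ h z Complex.I * u z))))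
  simp only [Nat.add_one_sub_one, pow_one, nsmul_eq_mul, Nat.cast_ofNat]
  linarith

/-- The two-dimensional ∂̄-Carleman inequality of Donnelly–Fefferman. -/
theorem carleman_dbar (D : Set ℂ) (hD : IsOpen D) (h : ℂ → ℝ)
    (hh : ContDiffOn ℝ (⊤ : ℕ∞) h D)
    (f : ℂ → ℂ) (hf : ContDiff ℝ (⊤ : ℕ∞) f) (hsupp : HasCompactSupport f)
    (hts : tsupport f ⊆ D) :
    (1/4) * ∫ z in D, planarLap h z * ‖f z‖^2 * Real.exp (h z) ≤
      ∫ z in D,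
        ‖(fderiv ℝ f z 1 + Complex.I • fderiv ℝ f z Complex.I) / 2‖^2 *
          Real.exp (h z) := by
  obtain ⟨K, hK, hfK, hKD⟩ := exists_compact_between hsupp hD hts
  obtain ⟨χ, h1, h0, -⟩ := exists_contMDiffMap_one_nhds_of_subset_interior
    (n := (⊤ : ℕ∞)) (modelWithCornersSelf ℝ ℂ) (isClosed_tsupport f) hfK
  have hχ : ContDiff ℝ (⊤ : ℕ∞) χ := χ.contMDiff.contDiff
  set g : ℂ → ℝ := fun z => χ z * h z with hg
  have sg : ContDiff ℝ (⊤ : ℕ∞) g := by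
    rw [contDiff_iff_contDiffAt]
    intro z
    by_cases hz : z ∈ D
    · exact hχ.contDiffAt.mul (hh.contDiffAt (hD.mem_nhds hz))
    · have hzK : z ∈ Kᶜ := fun hk => hz (hKD hk)
      have : g =ᶠ[nhds z] fun _ => 0 := by
        filter_upwards [hK.isClosed.isOpen_compl.mem_nhds hzK] with w hw
        simp [hg, h0 w hw]
      exact contDiffAt_const.congr_of_eventuallyEq this
  have hgh : ∀ z ∈ tsupport f, g =ᶠ[nhds z] h := by
    intro z hz
    filter_upwards [Filter.Eventually.filter_mono (nhds_le_nhdsSet hz) h1] with w hw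
    simp [hg, hw]
  have hre : ContDiff ℝ (⊤ : ℕ∞) (fun z => (f z).re) := Complex.reCLM.contDiff.comp hf
  have him : ContDiff ℝ (⊤ : ℕ∞) (fun z => (f z).im) := Complex.imCLM.contDiff.comp hf
  have main := cb_global (fun z => (f z).re) (fun z => (f z).im) g hre him sg
    (hsupp.comp_left (g := Complex.re) rfl) (hsupp.comp_left (g := Complex.im) rfl)
  have dre : ∀ z e, fderiv ℝ (fun z => (f z).re) z e = (fderiv ℝ f z e).re := by
    intro z e
    have := (Complex.reCLM.hasFDerivAt.comp z (hf.differentiable (by simp) z).hasFDerivAt).fderiv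
    exact congrArg (fun L : ℂ →L[ℝ] ℝ => L e) this
  have dim : ∀ z e, fderiv ℝ (fun z => (f z).im) z e = (fderiv ℝ f z e).im := by
    intro z e
    have := (Complex.imCLM.hasFDerivAt.comp z (hf.differentiable (by simp) z).hasFDerivAt).fderiv
    exact congrArg (fun L : ℂ →L[ℝ] ℝ => L e) this
  have nt : ∀ z, z ∉ tsupport f → f z = 0 ∧ fderiv ℝ f z = 0 := fun z hz =>
    ⟨image_eq_zero_of_notMem_tsupport hz, fderiv_of_notMem_tsupport ℝ hz⟩
  rw [MeasureTheory.setIntegral_eq_integral_of_forall_compl_eq_zero,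
    MeasureTheory.setIntegral_eq_integral_of_forall_compl_eq_zero]
  rotate_left
  · intro z hz
    simp [(nt z fun h => hz (hts h)).2]
  · intro z hz
    simp [(nt z fun h => hz (hts h)).1]
  have e1 : (fun z => planarLap h z * ‖f z‖^2 * Real.exp (h z)) =
      fun z => planarLap g z * ((f z).re^2 + (f z).im^2) * Real.exp (g z) := by
    funext z
    by_cases hz : z ∈ tsupport f
    · have hE := hgh z hz
      have hp : planarLap g z = planarLap h z := by
        have a : ∀ e, (fun w => fderiv ℝ g w e) =ᶠ[nhds z] fun w => fderiv ℝ h w e := by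
          intro e
          filter_upwards [hE.fderiv (𝕜 := ℝ)] with w hw
          rw [hw]
        simp only [planarLap, (a _).fderiv_eq]
      rw [hp, hE.eq_of_nhds, Complex.sq_norm, Complex.normSq_apply]
      ring
    · simp [(nt z hz).1]
  have e2 : (fun z => ‖(fderiv ℝ f z 1 + Complex.I • fderiv ℝ f z Complex.I) / 2‖^2 *
          Real.exp (h z)) =
      fun z => (1/4) * ((((fderiv ℝ (fun z => (f z).re) z 1
        - fderiv ℝ (fun z => (f z).im) z Complex.I)^2 +
        (fderiv ℝ (fun z => (f z).im) z 1
          + fderiv ℝ (fun z => (f z).re) z Complex.I)^2)) * Real.exp (g z)) := by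
    funext z
    simp only [dre, dim]
    by_cases hz : z ∈ tsupport f
    · rw [(hgh z hz).eq_of_nhds, norm_div, div_pow, Complex.sq_norm, Complex.normSq_apply]
      simp
      ring
    · simp [(nt z hz).2]
  rw [e1, e2, MeasureTheory.integral_const_mul]
  exact mul_le_mul_of_nonneg_left main (by norm_num)
end
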